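/- Let 0 < a₁ < a₂ and b₂ > 0 be real numbers, and set b₁ = √(b₂² + ((a₂ − a₁)/2)²). For t ∈ ℝ define z(t) = i(a₁+a₂)/2 + i·b₁·cos t + b₂·sin t (a parametrization of the ellipse ∂Ω₂ with foci ia₁, ia₂) and w(t) = b₁·sin t + i·b₂·cos t. Then: (i) w(t)² = (z(t) − i a₁)·(z(t) − i a₂); and (ii) conj(z(t)) = (1 − 8b₁²/(a₂ − a₁)²)·(z(t) − i(a₁+a₂)/2) + (8b₁b₂/(a₂ − a₁)²)·w(t) − i(a₁+a₂)/2. -/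

import Mathlib

open Complex

/-- Boundary identity for the elliptic domain (Lemma 6.1): with
`z(t) = i(a₁+a₂)/2 + i b₁ cos t + b₂ sin t` parametrizing the ellipse with foci `ia₁, ia₂`
(`b₁ = √(b₂² + ((a₂-a₁)/2)²)`) and `w(t) = b₁ sin t + i b₂ cos t`, one has
`w(t)² = (z(t) - ia₁)(z(t) - ia₂)` and
`conj(z(t)) = (1 - 8b₁²/(a₂-a₁)²)(z(t) - i(a₁+a₂)/2) + (8b₁b₂/(a₂-a₁)²) w(t) - i(a₁+a₂)/2`. -/
theorem ellipse_boundary_identity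
    (a₁ a₂ b₁ b₂ : ℝ) (h1 : 0 < a₁) (h2 : a₁ < a₂) (h3 : 0 < b₂)
    (hb₁ : b₁ = Real.sqrt (b₂ ^ 2 + ((a₂ - a₁) / 2) ^ 2))
    (z w : ℝ → ℂ)
    (hz : ∀ t : ℝ, z t = I * (((a₁ + a₂) / 2 : ℝ) : ℂ) +
      I * (b₁ : ℂ) * ((Real.cos t : ℝ) : ℂ) + (b₂ : ℂ) * ((Real.sin t : ℝ) : ℂ))
    (hw : ∀ t : ℝ, w t = (b₁ : ℂ) * ((Real.sin t : ℝ) : ℂ) +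
      I * (b₂ : ℂ) * ((Real.cos t : ℝ) : ℂ))
    (t : ℝ) :
    (w t) ^ 2 = (z t - I * (a₁ : ℂ)) * (z t - I * (a₂ : ℂ)) ∧
      (starRingEnd ℂ) (z t)
        = ((1 - 8 * b₁ ^ 2 / (a₂ - a₁) ^ 2 : ℝ) : ℂ) *
            (z t - I * (((a₁ + a₂) / 2 : ℝ) : ℂ)) +
          ((8 * b₁ * b₂ / (a₂ - a₁) ^ 2 : ℝ) : ℂ) * w t -
          I * (((a₁ + a₂) / 2 : ℝ) : ℂ) := by
  have hb : b₁ ^ 2 = b₂ ^ 2 + ((a₂ - a₁) / 2) ^ 2 := by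
    rw [hb₁, Real.sq_sqrt (by positivity)]
  have hd : a₂ - a₁ ≠ 0 := sub_ne_zero.mpr h2.ne'
  have hsc := Real.sin_sq_add_cos_sq t
  rw [hz, hw]
  generalize Real.sin t = s at hsc ⊢
  generalize Real.cos t = c at hsc ⊢
  clear hb₁ hz hw
  constructor
  · apply Complex.ext
    · simp [pow_two, -ofReal_div, -ofReal_add]
      linear_combination (b₁ ^ 2 - b₂ ^ 2) * hsc + hb
    · simp [pow_two, -ofReal_div, -ofReal_add]
      ring
  · apply Complex.ext
    · simp only [conj_re, add_re, sub_re, mul_re, ofReal_re, ofReal_im, I_re, I_im,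
        add_im, sub_im, mul_im]
      field_simp
      ring
    · simp only [conj_im, add_re, sub_re, mul_re, ofReal_re, ofReal_im, I_re, I_im,
        add_im, sub_im, mul_im]
      field_simp
      linear_combination 16 * b₁ * c * hb
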